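/- arXiv:1910.02209 — 3 statements merged into one kernel-verified Lean document; each statement's English description precedes it below -/
import Mathlib

section
/- For any cycle C of length at least k in G, the maximal good set containing V(C) is unique; that is, H(C) is well defined. -/
/-- `X ⊆ V(G)` is good (w.r.t. `k`) if every vertex of `X` lies on a cycle of length
at least `k/2` in `G[X]`, and any two distinct vertices of `X` are joined by a path
of length at least `k/2` in `G[X]`. -/
def Good {V : Type*} (G : SimpleGraph V) (k : ℕ) (X : Set V) : Prop :=
  (∀ u : X, ∃ c : (G.induce X).Walk u u, c.IsCycle ∧ k ≤ 2 * c.length) ∧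
  (∀ u v : X, u ≠ v → ∃ p : (G.induce X).Walk u v, p.IsPath ∧ k ≤ 2 * p.length)

namespace SimpleGraph.Walk

variable {V : Type*} {G : SimpleGraph V}

theorem support_induce_map_subset {X : Set V} {a b : X} (p : (G.induce X).Walk a b) :
    ∀ w ∈ (p.map (Embedding.induce X).toHom).support, w ∈ X := by
  intro w hw
  rw [support_map, List.mem_map] at hw
  obtain ⟨z, -, rfl⟩ := hw
  exact z.2

theorem IsPath.exists_induce {X : Set V} {a b : V} {p : G.Walk a b} (hp : p.IsPath)
    (hX : ∀ w ∈ p.support, w ∈ X) :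
    ∃ q : (G.induce X).Walk ⟨a, hX _ p.start_mem_support⟩ ⟨b, hX _ p.end_mem_support⟩,
      q.IsPath ∧ q.length = p.length := by
  have h := map_induce p hX
  refine ⟨p.induce X hX, ?_, ?_⟩
  · apply IsPath.of_map (f := (Embedding.induce X).toHom)
    rw [h]
    exact hp
  · exact (length_map _ _).symm.trans (congrArg length h)

/-- A path from `a` into `Y` can be rerouted at its first vertex in `Y` along a path inside `Y`. -/
theorem IsPath.exists_reroute {Y : Set V} {y : V} {n : ℕ}
    {a t : V} {p : G.Walk a t} (hp : p.IsPath) (ht : t ∈ Y)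
    (hY : ∀ s ∈ p.support, s ∈ Y →
      ∃ q : G.Walk s y, q.IsPath ∧ n ≤ q.length ∧ ∀ w ∈ q.support, w ∈ Y) :
    ∃ q : G.Walk a y, q.IsPath ∧ n ≤ q.length ∧ ∀ w ∈ q.support, w ∈ p.support ∨ w ∈ Y := by
  induction p with
  | nil =>
    obtain ⟨q, hq, hn, hs⟩ := hY _ (by simp) ht
    exact ⟨q, hq, hn, fun w hw => Or.inr (hs w hw)⟩
  | @cons a b t h p ih =>
    by_cases ha : a ∈ Y
    · obtain ⟨q, hq, hn, hs⟩ := hY a (by simp) ha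
      exact ⟨q, hq, hn, fun w hw => Or.inr (hs w hw)⟩
    · rw [cons_isPath_iff] at hp
      obtain ⟨q, hq, hn, hs⟩ := ih hp.1 ht fun s hsp => hY s (by simp [hsp])
      refine ⟨cons h q, ?_, ?_, ?_⟩
      · rw [cons_isPath_iff]
        exact ⟨hq, fun haq => (hs a haq).elim hp.2 ha⟩
      · rw [length_cons]
        omega
      · intro w hw
        rw [support_cons, List.mem_cons] at hw ⊢
        rcases hw with hw | hw
        · exact Or.inl (Or.inl hw)
        · exact (hs w hw).imp_left Or.inr

end SimpleGraph.Walk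

namespace Good

variable {V : Type*} {G : SimpleGraph V} {k : ℕ} {X Y : Set V}

theorem exists_path (hX : Good G k X) {a b : V} (ha : a ∈ X) (hb : b ∈ X) (hab : a ≠ b) :
    ∃ p : G.Walk a b, p.IsPath ∧ k ≤ 2 * p.length ∧ ∀ w ∈ p.support, w ∈ X := by
  obtain ⟨p, hp, hk⟩ := hX.2 ⟨a, ha⟩ ⟨b, hb⟩ (by simpa using hab)
  refine ⟨p.map (SimpleGraph.Embedding.induce X).toHom, ?_, ?_, p.support_induce_map_subset⟩
  · exact hp.map (SimpleGraph.Embedding.induce (G := G) X).injective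
  · exact hk.trans_eq (congrArg (2 * ·) (SimpleGraph.Walk.length_map _ _).symm)

theorem exists_path_union (hX : Good G k X) (hY : Good G k Y) {t x y : V} (htX : t ∈ X)
    (htY : t ∈ Y) (hx : x ∈ X) (hy : y ∈ Y) (hyX : y ∉ X) :
    ∃ p : G.Walk x y, p.IsPath ∧ k ≤ 2 * p.length ∧ ∀ w ∈ p.support, w ∈ X ∪ Y := by
  obtain ⟨p, hp, hpX⟩ : ∃ p : G.Walk x t, p.IsPath ∧ ∀ w ∈ p.support, w ∈ X := by
    by_cases hxt : x = t
    · subst hxt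
      exact ⟨.nil, .nil, by simpa using hx⟩
    · obtain ⟨p, hp, -, hs⟩ := hX.exists_path hx htX hxt
      exact ⟨p, hp, hs⟩
  obtain ⟨q, hq, hn, hs⟩ := hp.exists_reroute (y := y) (n := (k + 1) / 2) htY fun s hsp hsY => by
    obtain ⟨q, hq, hn, hs⟩ := hY.exists_path hsY hy fun h => hyX (h ▸ hpX s hsp)
    exact ⟨q, hq, by omega, hs⟩
  exact ⟨q, hq, by omega, fun w hw => (hs w hw).imp_left (hpX w)⟩

theorem exists_cycle_of_subset (hX : Good G k X) (h : X ⊆ Y) {a : V} (ha : a ∈ X) :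
    ∃ c : (G.induce Y).Walk ⟨a, h ha⟩ ⟨a, h ha⟩, c.IsCycle ∧ k ≤ 2 * c.length := by
  obtain ⟨c, hc, hk⟩ := hX.1 ⟨a, ha⟩
  refine ⟨c.map (SimpleGraph.induceHomOfLE G h).toHom, ?_, ?_⟩
  · exact hc.map (SimpleGraph.induceHomOfLE G h).injective
  · exact hk.trans_eq (congrArg (2 * ·) (SimpleGraph.Walk.length_map _ _).symm)

/-- Good sets that meet have a good union. -/
theorem union (hX : Good G k X) (hY : Good G k Y) (hXY : (X ∩ Y).Nonempty) :
    Good G k (X ∪ Y) := by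
  obtain ⟨t, htX, htY⟩ := hXY
  constructor
  · rintro ⟨a, ha | ha⟩
    · exact hX.exists_cycle_of_subset Set.subset_union_left ha
    · exact hY.exists_cycle_of_subset Set.subset_union_right ha
  · rintro ⟨a, ha⟩ ⟨b, hb⟩ hab
    have hab : a ≠ b := by simpa using hab
    obtain ⟨p, hp, hk, hs⟩ :
        ∃ p : G.Walk a b, p.IsPath ∧ k ≤ 2 * p.length ∧ ∀ w ∈ p.support, w ∈ X ∪ Y := by
      by_cases hX' : a ∈ X ∧ b ∈ X
      · obtain ⟨p, hp, hk, hs⟩ := hX.exists_path hX'.1 hX'.2 hab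
        exact ⟨p, hp, hk, fun w hw => Or.inl (hs w hw)⟩
      by_cases hY' : a ∈ Y ∧ b ∈ Y
      · obtain ⟨p, hp, hk, hs⟩ := hY.exists_path hY'.1 hY'.2 hab
        exact ⟨p, hp, hk, fun w hw => Or.inr (hs w hw)⟩
      rcases ha with ha | ha
      · have hbX : b ∉ X := fun h => hX' ⟨ha, h⟩
        exact hX.exists_path_union hY htX htY ha (hb.resolve_left hbX) hbX
      · have hbY : b ∉ Y := fun h => hY' ⟨ha, h⟩
        rw [Set.union_comm]
        exact hY.exists_path_union hX htY htX ha (hb.resolve_right hbY) hbY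
    obtain ⟨q, hq, hl⟩ := hp.exists_induce hs
    exact ⟨q, hq, by omega⟩

end Good

/-- For a cycle `C` of length at least `k`, the maximal good set containing `V(C)`
is unique, i.e. `H(C)` is well defined. -/
theorem stmt_7 {V : Type*} (G : SimpleGraph V) (k : ℕ)
    (u : V) (c : G.Walk u u) (hc : c.IsCycle) (hk : k ≤ c.length)
    (H₁ H₂ : Set V) (hH₁ : Good G k H₁) (hH₂ : Good G k H₂)
    (hC₁ : {v | v ∈ c.support} ⊆ H₁) (hC₂ : {v | v ∈ c.support} ⊆ H₂)
    (hmax₁ : ∀ H' : Set V, Good G k H' → H₁ ⊆ H' → H' = H₁)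
    (hmax₂ : ∀ H' : Set V, Good G k H' → H₂ ⊆ H' → H' = H₂) :
    H₁ = H₂ := by
  have h : Good G k (H₁ ∪ H₂) :=
    hH₁.union hH₂ ⟨u, hC₁ c.start_mem_support, hC₂ c.start_mem_support⟩
  rw [← hmax₁ _ h Set.subset_union_left]
  exact hmax₂ _ h Set.subset_union_right
end

section
/- Let k/2 ≤ r ≤ k-3 and let G be a simple graph on n vertices with more than (k-1)n/2 edges. Then G contains a keyring with r leaves and at least k edges. -/
/-- `G` contains a keyring with `r` leaves and at least `k` edges: a cycle with `r`
pendant vertices (outside the cycle) attached to one of its vertices, with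
`cycle length + r ≥ k` edges in total. -/
def HasKeyring {V : Type*} [DecidableEq V] (G : SimpleGraph V) (r k : ℕ) : Prop :=
  ∃ (u : V) (c : G.Walk u u) (L : Finset V), c.IsCycle ∧ L.card = r ∧
    (∀ v ∈ L, G.Adj u v ∧ v ∉ c.support) ∧ k ≤ c.length + r

namespace SimpleGraph

open Finset

variable {V : Type*} [DecidableEq V] {G : SimpleGraph V}

omit [DecidableEq V] in
lemma Walk.IsPath.append_of_inter {u v w : V} {p : G.Walk u v} {q : G.Walk v w}
    (hp : p.IsPath) (hq : q.IsPath) (h : ∀ x ∈ p.support, x ∈ q.support → x = v) :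
    (p.append q).IsPath := by
  have hq' := hq.support_nodup
  rw [← Walk.cons_tail_support, List.nodup_cons] at hq'
  refine Walk.IsPath.mk' ?_
  rw [Walk.support_append]
  refine hp.support_nodup.append hq'.2 fun x hx hx' => ?_
  exact hq'.1 (h x hx (List.mem_of_mem_tail hx') ▸ hx')

/-- Either `u` is joined to `b` by a path with all vertices but `b` in `A`, or the component
of `u` in `A` has no vertex adjacent to `b`. -/
lemma exists_isPath_or_component (A : Finset V) {u b : V} (hu : u ∈ A) :
    (∃ p : G.Walk u b, p.IsPath ∧ ∀ w ∈ p.support, w ∈ A ∨ w = b) ∨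
    ∃ D ⊆ A, u ∈ D ∧ (∀ w ∈ D, ∀ z ∈ A, G.Adj w z → z ∈ D) ∧ ∀ w ∈ D, ¬ G.Adj w b := by
  classical
  by_cases h : ∃ (w : V) (p : G.Walk u w), (∀ z ∈ p.support, z ∈ A) ∧ G.Adj w b
  · obtain ⟨w, p, hp, hwb⟩ := h
    refine .inl ⟨(p.concat hwb).bypass, Walk.bypass_isPath _, fun z hz => ?_⟩
    have := Walk.support_bypass_subset_support _ hz
    rw [Walk.support_concat] at this
    simp only [List.mem_append, List.mem_singleton] at this
    exact this.imp_left (hp z)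
  · push Not at h
    refine .inr ⟨{w ∈ A | ∃ p : G.Walk u w, ∀ z ∈ p.support, z ∈ A}, filter_subset _ _, ?_, ?_, ?_⟩
    · exact mem_filter.2 ⟨hu, .nil, by simpa using hu⟩
    · intro w hw z hz hwz
      obtain ⟨-, p, hp⟩ := mem_filter.1 hw
      refine mem_filter.2 ⟨hz, p.concat hwz, fun y hy => ?_⟩
      rw [Walk.support_concat] at hy
      simp only [List.mem_append, List.mem_singleton] at hy
      rcases hy with hy | rfl
      exacts [hp y hy, hz]
    · intro w hw
      obtain ⟨-, p, hp⟩ := mem_filter.1 hw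
      exact h w p hp

variable (G) in
/-- In `G - X`, the nonempty set `B` is attached to the rest of the graph only through `b`. -/
structure IsLobe (X B : Finset V) (b : V) : Prop where
  nonempty : B.Nonempty
  disjoint : Disjoint B X
  notMem : b ∉ B
  notMem_removed : b ∉ X
  closed : ∀ u ∈ B, ∀ w, G.Adj u w → w ∈ B ∨ w = b ∨ w ∈ X

/-- A form of the Erdős–Gallai lemma on long paths between two vertices of an end block. -/
lemma IsLobe.exists_isPath [Fintype V] [DecidableRel G.Adj] (d : ℕ) :
    ∀ {X B : Finset V} {b : V}, G.IsLobe X B b →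
    (∀ B' b', B' ⊂ B → ¬ G.IsLobe X B' b') →
    (∀ u ∈ B, d + 1 ≤ #(G.neighborFinset u \ X)) → ∀ x ∈ B,
    ∃ p : G.Walk x b, p.IsPath ∧ d + 1 ≤ p.length ∧ ∀ w ∈ p.support, w ∈ B ∨ w = b := by
  induction d with
  | zero =>
    intro X B b hB hmin hdeg x hx
    have hxb : x ≠ b := fun h => hB.notMem (h ▸ hx)
    rcases exists_isPath_or_component (G := G) B (b := b) hx with ⟨p, hp, hs⟩ | ⟨D, hDB, hxD, hD, hDb⟩
    · exact ⟨p, hp, Nat.one_le_iff_ne_zero.2 fun h => hxb (Walk.eq_of_length_eq_zero h), hs⟩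
    · exfalso
      obtain ⟨w, hw⟩ := card_pos.1 (hdeg x hx)
      rw [mem_sdiff, mem_neighborFinset] at hw
      have hwB : w ∈ B := by
        rcases hB.closed x hx w hw.1 with h | rfl | h
        exacts [h, (hDb x hxD hw.1).elim, (hw.2 h).elim]
      refine hmin (D.erase x) x ⟨(erase_subset _ _).trans hDB, fun h => notMem_erase x D (h hx)⟩
        ⟨⟨w, mem_erase.2 ⟨hw.1.ne', hD x hxD w hwB hw.1⟩⟩, ?_, notMem_erase _ _,
          Finset.disjoint_left.1 hB.disjoint hx, ?_⟩
      · exact hB.disjoint.mono_left ((erase_subset _ _).trans hDB)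
      · intro u hu z huz
        have huD := mem_of_mem_erase hu
        rcases hB.closed u (hDB huD) z huz with h | rfl | h
        · by_cases hzx : z = x
          · exact .inr (.inl hzx)
          · exact .inl (mem_erase.2 ⟨hzx, hD u huD z h huz⟩)
        · exact (hDb u huD huz).elim
        · exact .inr (.inr h)
  | succ d ih =>
    intro X B b hB hmin hdeg x hx
    have hxb : x ≠ b := fun h => hB.notMem (h ▸ hx)
    have hxX : x ∉ X := Finset.disjoint_left.1 hB.disjoint hx
    have hlobe : G.IsLobe (insert x X) (B.erase x) b := by
      refine ⟨?_, ?_, fun h => hB.notMem (mem_of_mem_erase h), ?_, ?_⟩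
      · obtain ⟨w, hw, hwb⟩ := exists_mem_ne (lt_of_lt_of_le (by lia) (hdeg x hx)) b
        rw [mem_sdiff, mem_neighborFinset] at hw
        refine ⟨w, mem_erase.2 ⟨hw.1.ne', ?_⟩⟩
        rcases hB.closed x hx w hw.1 with h | h | h
        exacts [h, (hwb h).elim, (hw.2 h).elim]
      · rw [disjoint_insert_right]
        exact ⟨notMem_erase _ _, hB.disjoint.mono_left (erase_subset _ _)⟩
      · simpa [hxb.symm] using hB.notMem_removed
      · intro u hu w huw
        have := hB.closed u (mem_of_mem_erase hu) w huw
        simp only [mem_erase, mem_insert]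
        tauto
    obtain ⟨B₁, hB₁B, ⟨b₁, hB₁⟩, hB₁min⟩ : ∃ B₁ ⊆ B.erase x, (∃ b₁, G.IsLobe (insert x X) B₁ b₁) ∧
        ∀ B' b', B' ⊂ B₁ → ¬ G.IsLobe (insert x X) B' b' := by
      obtain ⟨B₁, hle, hmin⟩ := exists_minimal_le_of_wellFoundedLT
        (fun B' => ∃ b', G.IsLobe (insert x X) B' b') (B.erase x) ⟨b, hlobe⟩
      exact ⟨B₁, hle, hmin.1, fun B' b' hlt hl => hlt.2 (hmin.2 ⟨b', hl⟩ hlt.1)⟩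
    have hxB₁ : x ∉ B₁ := fun h => notMem_erase x B (hB₁B h)
    have hB₁sub : B₁ ⊆ B := hB₁B.trans (erase_subset _ _)
    have hssub : B₁ ⊂ B := ⟨hB₁sub, fun h => hxB₁ (h hx)⟩
    have hdisj : Disjoint B₁ X := hB.disjoint.mono_left hB₁sub
    have hb₁ := hB₁.notMem_removed
    rw [mem_insert, not_or] at hb₁
    have hb₁B : b₁ ∈ B ∨ b₁ = b := by
      by_contra hcon
      rw [not_or] at hcon
      refine hmin B₁ x hssub ⟨hB₁.nonempty, hdisj, hxB₁, hxX, fun u hu w huw => ?_⟩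
      have h1 := hB₁.closed u hu w huw
      have h2 := hB.closed u (hB₁sub hu) w huw
      rw [mem_insert] at h1
      grind
    obtain ⟨x', hx', hxx'⟩ : ∃ x' ∈ B₁, G.Adj x x' := by
      by_contra! hcon
      refine hmin B₁ b₁ hssub ⟨hB₁.nonempty, hdisj, hB₁.notMem, hb₁.2, fun u hu w huw => ?_⟩
      rcases hB₁.closed u hu w huw with h | h | h
      · exact .inl h
      · exact .inr (.inl h)
      · rcases mem_insert.1 h with rfl | h
        · exact (hcon u hu huw.symm).elim
        · exact .inr (.inr h)
    obtain ⟨p, hp, hlen, hps⟩ := ih hB₁ hB₁min (fun u hu => by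
      have h1 := hdeg u (hB₁sub hu)
      have h2 := card_le_card (s := G.neighborFinset u \ X)
        (t := insert x (G.neighborFinset u \ insert x X)) (fun w hw => by grind)
      have h3 := card_insert_le x (G.neighborFinset u \ insert x X)
      lia) x' hx'
    obtain ⟨q, hq, hqs⟩ : ∃ q : G.Walk b₁ b, q.IsPath ∧
        ∀ w ∈ q.support, w ∈ B.erase x \ B₁ ∨ w = b := by
      rcases eq_or_ne b₁ b with rfl | hne
      · exact ⟨.nil, .nil, by simp⟩
      have hb₁A : b₁ ∈ B.erase x \ B₁ :=
        mem_sdiff.2 ⟨mem_erase.2 ⟨hb₁.1, hb₁B.resolve_right hne⟩, hB₁.notMem⟩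
      refine (exists_isPath_or_component _ hb₁A).resolve_right ?_
      rintro ⟨D, hDA, hb₁D, hD, hDb⟩
      have hDB : D ⊆ B := fun w hw => mem_of_mem_erase (mem_sdiff.1 (hDA hw)).1
      have hxD : x ∉ D := fun h => notMem_erase x B (mem_sdiff.1 (hDA h)).1
      have hxDB : x ∉ D ∪ B₁ := by simp [hxD, hxB₁]
      have hsub : D ∪ B₁ ⊆ B := union_subset hDB hB₁sub
      refine hmin (D ∪ B₁) x ⟨hsub, fun h => hxDB (h hx)⟩
        ⟨⟨b₁, mem_union_left _ hb₁D⟩, hB.disjoint.mono_left hsub, hxDB, hxX, fun u hu w huw => ?_⟩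
      rcases mem_union.1 hu with hu | hu
      · have h1 := hB.closed u (hDB hu) w huw
        have h2 := hD u hu w
        have h3 := hDb u hu
        grind
      · have h1 := hB₁.closed u hu w huw
        grind
    have hbB₁ : b ∉ B₁ := fun h => hB.notMem (hB₁sub h)
    have happ := hp.append_of_inter hq fun w hw hw' => by
      have h1 := hps w hw
      have h2 := hqs w hw'
      grind
    refine ⟨.cons hxx' (p.append q), happ.cons ?_, ?_, ?_⟩
    · rw [Walk.mem_support_append_iff]
      rintro (h | h)
      · exact (hps x h).elim hxB₁ (Ne.symm hb₁.1)
      · have := hqs x h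
        grind
    · rw [Walk.length_cons, Walk.length_append]
      lia
    · intro w hw
      rw [Walk.support_cons, List.mem_cons, Walk.mem_support_append_iff] at hw
      rcases hw with rfl | hw | hw
      · exact .inl hx
      · have := hps w hw
        grind
      · have := hqs w hw
        grind

section Count

variable [DecidableRel G.Adj]

omit [DecidableEq V] in
lemma card_interedges_eq_sum (A C : Finset V) :
    #(G.interedges A C) = ∑ u ∈ A, #{w ∈ C | G.Adj u w} := by
  rw [interedges_def, card_filter, sum_product]
  simp only [card_filter]

lemma card_interedges_union_self {A C : Finset V} (h : Disjoint A C) :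
    #(G.interedges (A ∪ C) (A ∪ C)) =
      #(G.interedges A A) + 2 * #(G.interedges A C) + #(G.interedges C C) := by
  have : Std.Symm G.Adj := ⟨fun _ _ h => h.symm⟩
  have hcomm : #(G.interedges C A) = #(G.interedges A C) := Rel.card_interedges_comm _ _
  have hr : ∀ E : Finset V, #(G.interedges E (A ∪ C)) =
      #(G.interedges E A) + #(G.interedges E C) := fun E => by
    rw [← card_union_of_disjoint (G.interedges_disjoint_right E h)]
    congr 1
    ext
    simp only [mem_interedges_iff, mem_union]
    tauto
  have hl : #(G.interedges (A ∪ C) (A ∪ C)) =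
      #(G.interedges A (A ∪ C)) + #(G.interedges C (A ∪ C)) := by
    rw [← card_union_of_disjoint (G.interedges_disjoint_left h _)]
    congr 1
    ext
    simp only [mem_interedges_iff, mem_union]
    tauto
  rw [hl, hr, hr, hcomm]
  ring

omit [DecidableEq V] in
lemma card_interedges_singleton_self (u : V) : #(G.interedges {u} {u}) = 0 := by
  simp [card_interedges_eq_sum]

end Count

/-- A vertex `v` of degree at least `r + m` on a cycle of length at least `m + 1` (given as a
path closed by an edge) is the centre of a keyring with `r` leaves. -/
lemma hasKeyring_of_isPath [Fintype V] [DecidableRel G.Adj] {r m : ℕ} (hm : 2 ≤ m) {v : V}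
    (hdeg : r + m ≤ G.degree v)
    (h : ∃ (b : V) (p : G.Walk v b), G.Adj v b ∧ p.IsPath ∧ m ≤ p.length) :
    HasKeyring G r (r + m + 1) := by
  classical
  have h' : ∃ (N : ℕ) (b : V) (p : G.Walk v b), G.Adj v b ∧ p.IsPath ∧ m ≤ p.length ∧
      p.length = N := by
    obtain ⟨b, p, h1, h2, h3⟩ := h
    exact ⟨_, b, p, h1, h2, h3, rfl⟩
  obtain ⟨b, p, hvb, hp, hmp, hN⟩ := Nat.find_spec h'
  have hmin : ∀ (w : V) (q : G.Walk v w), G.Adj v w → q.IsPath → q.length < p.length →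
      q.length < m := by
    intro w q hw hq hlt
    by_contra hcon
    exact Nat.find_min h' (hN ▸ hlt) ⟨w, q, hw, hq, not_lt.1 hcon, rfl⟩
  have hsub : {w ∈ G.neighborFinset v | w ∈ p.support} ⊆
      insert b ((Finset.Ico 1 m).image p.getVert) := by
    intro w hw
    rw [mem_filter, mem_neighborFinset] at hw
    obtain ⟨hvw, hw⟩ := hw
    rw [mem_insert, or_iff_not_imp_left]
    intro hwb
    have := hmin w (p.takeUntil w hw) hvw (hp.takeUntil hw) (Walk.length_takeUntil_lt_length hw hwb)
    refine mem_image.2 ⟨(p.takeUntil w hw).length, mem_Ico.2 ⟨?_, this⟩,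
      Walk.getVert_length_takeUntil hw⟩
    exact Nat.one_le_iff_ne_zero.2 fun h => hvw.ne (Walk.eq_of_length_eq_zero h)
  have hcard : #{w ∈ G.neighborFinset v | w ∈ p.support} ≤ m := by
    have h1 := card_le_card hsub
    have h2 := card_insert_le b ((Finset.Ico 1 m).image p.getVert)
    have h3 := card_image_le (s := Finset.Ico 1 m) (f := p.getVert)
    rw [Nat.card_Ico] at h3
    lia
  have hsplit := card_filter_add_card_filter_not (s := G.neighborFinset v) (· ∈ p.support)
  rw [card_neighborFinset_eq_degree] at hsplit
  obtain ⟨L, hL, hLc⟩ := exists_subset_card_eq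
    (s := {w ∈ G.neighborFinset v | w ∉ p.support}) (n := r) (by lia)
  refine ⟨v, .cons hvb p.reverse, L, ?_, hLc, fun w hw => ?_, ?_⟩
  · rw [Walk.cons_isCycle_iff]
    refine ⟨hp.reverse, fun he => ?_⟩
    rw [Walk.edges_reverse, List.mem_reverse] at he
    have := hp.length_eq_one_of_mem_edges he
    lia
  · have := hL hw
    rw [mem_filter, mem_neighborFinset] at this
    refine ⟨this.1, ?_⟩
    rw [Walk.support_cons, List.mem_cons, Walk.support_reverse, List.mem_reverse]
    rintro (rfl | h)
    exacts [this.1.ne rfl, this.2 h]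
  · rw [Walk.length_cons, Walk.length_reverse]
    lia

/-- A minimal set spanning more than `K (s - 1) / 2` edges has minimum degree above `K / 2`,
a vertex of degree at least `K`, and no cut vertex. -/
lemma exists_dense_core [Fintype V] [DecidableRel G.Adj] {K : ℕ}
    (h : K * Fintype.card V < 2 * #G.edgeFinset) :
    ∃ S : Finset V, (∀ u ∈ S, K < 2 * #(G.neighborFinset u \ Sᶜ)) ∧
      (∃ v ∈ S, K ≤ G.degree v) ∧
      ∀ b ∈ S, ∀ B' b', B' ⊂ S.erase b → ¬ G.IsLobe Sᶜ B' b' := by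
  classical
  have hfilter : ∀ (u : V) (S : Finset V), G.neighborFinset u \ Sᶜ = {w ∈ S | G.Adj u w} := by
    intro u S
    ext
    simp [and_comm]
  have huniv : #(G.interedges univ univ) = 2 * #G.edgeFinset := by
    rw [← sum_degrees_eq_twice_card_edges, card_interedges_eq_sum]
    refine sum_congr rfl fun u _ => ?_
    rw [← card_neighborFinset_eq_degree, ← hfilter]
    simp
  have hne : (univ : Finset V).Nonempty := by
    by_contra hcon
    rw [not_nonempty_iff_eq_empty] at hcon
    rw [← huniv, hcon] at h
    simp at h
  obtain ⟨S, -, ⟨hSne, hS⟩, hmin⟩ := exists_minimal_le_of_wellFoundedLT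
    (fun S : Finset V => S.Nonempty ∧ K * #S < #(G.interedges S S) + K) univ
    ⟨hne, by rw [huniv, card_univ]; lia⟩
  have hsmall : ∀ T : Finset V, T.Nonempty → T ⊂ S → #(G.interedges T T) + K ≤ K * #T := by
    intro T hT hlt
    by_contra hcon
    exact hlt.2 (hmin ⟨hT, not_le.1 hcon⟩ hlt.1)
  refine ⟨S, fun u hu => ?_, ?_, ?_⟩
  · rw [hfilter]
    have hdisj : Disjoint {u} (S.erase u) := by simp
    have heq : {u} ∪ S.erase u = S := by rw [← insert_eq, insert_erase hu]
    have hD := card_interedges_union_self (G := G) hdisj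
    rw [heq, card_interedges_singleton_self, card_interedges_eq_sum {u}, sum_singleton] at hD
    have hf : #{w ∈ S.erase u | G.Adj u w} ≤ #{w ∈ S | G.Adj u w} :=
      card_le_card (filter_subset_filter _ (erase_subset _ _))
    have hc := card_erase_add_one hu
    rcases (S.erase u).eq_empty_or_nonempty with he | he
    · rw [he] at hD hc
      rw [← hc] at hS
      simp [hD] at hS
    · have := hsmall _ he (erase_ssubset hu)
      rw [← hc, mul_add] at hS
      lia
  · by_contra! hcon
    have hle : ∀ u ∈ S, #{w ∈ S | G.Adj u w} + 1 ≤ K := fun u hu => by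
      have h1 := hcon u hu
      have h2 : #{w ∈ S | G.Adj u w} ≤ G.degree u := by
        rw [← hfilter, ← card_neighborFinset_eq_degree]
        exact card_le_card sdiff_subset
      lia
    have hle' : ∀ u ∈ S, #{w ∈ S | G.Adj u w} + 1 ≤ #S := fun u hu => by
      refine card_lt_card ⟨filter_subset _ _, fun h => ?_⟩
      simpa using h hu
    have hsum : ∀ c, (∀ u ∈ S, #{w ∈ S | G.Adj u w} + 1 ≤ c) →
        #(G.interedges S S) + #S ≤ #S * c := fun c hc => by
      have := sum_le_card_nsmul S _ c hc
      rwa [sum_add_distrib, ← card_interedges_eq_sum, sum_const, smul_eq_mul, mul_one,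
        smul_eq_mul] at this
    have h1 := hsum K hle
    have h2 := hsum _ hle'
    have hpos := hSne.card_pos
    nlinarith
  · intro b hb B' b' hB' hl
    have hB'S : B' ⊆ S := hB'.1.trans (erase_subset _ _)
    have hb'S : b' ∈ S := by simpa using hl.notMem_removed
    have hcB' := card_lt_card hB'
    have hcS := card_erase_add_one hb
    set T := S \ B' with hT
    have hb'T : b' ∈ T := mem_sdiff.2 ⟨hb'S, hl.notMem⟩
    have hdisj : Disjoint B' T := disjoint_sdiff
    have heq : B' ∪ T = S := union_sdiff_of_subset hB'S
    have hcT : #B' + #T = #S := by rw [← card_union_of_disjoint hdisj, heq]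
    have hD := card_interedges_union_self (G := G) hdisj
    rw [heq] at hD
    have hdisj' : Disjoint B' {b'} := by simpa using hl.notMem
    have hD' := card_interedges_union_self (G := G) hdisj'
    rw [card_interedges_singleton_self] at hD'
    have hcU : #(B' ∪ {b'}) = #B' + 1 := by rw [card_union_of_disjoint hdisj', card_singleton]
    have hcross : #(G.interedges B' T) = #(G.interedges B' {b'}) := by
      congr 1
      ext ⟨u, w⟩
      simp only [mk_mem_interedges_iff, mem_singleton]
      refine ⟨fun ⟨hu, hw, huw⟩ => ⟨hu, ?_, huw⟩, fun ⟨hu, hw, huw⟩ => ⟨hu, hw ▸ hb'T, huw⟩⟩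
      have := hl.closed u hu w huw
      rw [mem_compl] at this
      grind
    have h1 := hsmall (B' ∪ {b'}) ⟨b', by simp⟩
      ⟨union_subset hB'S (by simpa using hb'S), fun h => by
        have := card_le_card h
        lia⟩
    have h2 := hsmall T ⟨b', hb'T⟩ ⟨sdiff_subset, fun h => by
        have := card_le_card h
        have := hl.nonempty.card_pos
        lia⟩
    rw [hcU, mul_add] at h1
    rw [← hcT, mul_add] at hS
    lia

end SimpleGraph

open SimpleGraph in
/-- For `k/2 ≤ r ≤ k-3`, every simple graph on `n` vertices with more than `(k-1)n/2`
edges contains a keyring with `r` leaves and at least `k` edges. -/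
theorem stmt_9 {V : Type*} [Fintype V] [DecidableEq V] (G : SimpleGraph V)
    [DecidableRel G.Adj] (n k r : ℕ) (hn : Fintype.card V = n)
    (hr₁ : k ≤ 2 * r) (hr₂ : r + 3 ≤ k)
    (he : ((k : ℝ) - 1) * n / 2 < G.edgeFinset.card) :
    HasKeyring G r k := by
  obtain ⟨m, rfl⟩ : ∃ m, k = r + m + 1 := ⟨k - r - 1, by lia⟩
  have he' : (r + m) * Fintype.card V < 2 * G.edgeFinset.card := by
    rw [hn]
    have : (((r + m) * n : ℕ) : ℝ) < ((2 * G.edgeFinset.card : ℕ) : ℝ) := by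
      push_cast at he ⊢
      linarith
    exact_mod_cast this
  obtain ⟨S, hdeg, ⟨v, hv, hvdeg⟩, hmin⟩ := exists_dense_core he'
  obtain ⟨b, hb⟩ := Finset.card_pos.1
    (show 0 < (G.neighborFinset v \ Sᶜ).card by have := hdeg v hv; lia)
  rw [Finset.mem_sdiff, mem_neighborFinset, Finset.mem_compl, not_not] at hb
  have hlobe : G.IsLobe Sᶜ (S.erase b) b := by
    refine ⟨⟨v, Finset.mem_erase.2 ⟨hb.1.ne, hv⟩⟩, ?_, Finset.notMem_erase _ _, by simpa using hb.2,
      fun u _ w _ => ?_⟩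
    · exact disjoint_compl_right.mono_left (Finset.erase_subset _ _)
    · simp only [Finset.mem_erase, Finset.mem_compl]
      tauto
  obtain ⟨p, hp, hlen, -⟩ := hlobe.exists_isPath (m - 1) (hmin b hb.2)
    (fun u hu => by have := hdeg u (Finset.mem_of_mem_erase hu); lia) v
    (Finset.mem_erase.2 ⟨hb.1.ne, hv⟩)
  exact hasKeyring_of_isPath (by lia) hvdeg ⟨b, p, hb.1, hp, by lia⟩
end

section
/- For every r with 0 ≤ r ≤ k-3, every simple graph on n vertices with more than (k-1)n/2 edges contains a keyring with exactly r leaves and at least k edges. -/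
universe u

namespace SimpleGraph

open Finset

variable {V : Type u}

/-- The vertices of `v :: l`, in this order, form a cycle of `G`. -/
structure IsCycleList (G : SimpleGraph V) (v : V) (l : List V) : Prop where
  nodup : (v :: l).Nodup
  chain : (v :: (l ++ [v])).IsChain G.Adj
  two_le : 2 ≤ l.length

theorem IsCycleList.rotate {G : SimpleGraph V} {v w : V} {l₁ l₂ : List V}
    (h : G.IsCycleList v (l₁ ++ w :: l₂)) : G.IsCycleList w (l₂ ++ v :: l₁) := by
  obtain ⟨h1, h2, h3⟩ := h
  refine ⟨?_, ?_, by simp at h3 ⊢; omega⟩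
  · grind
  · have : v :: (l₁ ++ w :: l₂ ++ [v]) = (v :: l₁) ++ (w :: (l₂ ++ [v])) := by simp
    have e1 : (v :: (l₁ ++ [w])).IsChain G.Adj := by
      refine h2.prefix ⟨l₂ ++ [v], by simp⟩
    have e2 : (w :: (l₂ ++ [v])).IsChain G.Adj := h2.suffix ⟨v :: l₁, by simp⟩
    have := List.IsChain.append_overlap (l₁ := w :: l₂) (l₂ := [v]) (l₃ := l₁ ++ [w])
      (by simpa using e2) (by simpa using e1) (by simp)
    simpa using this

theorem IsCycleList.exists_rotate {G : SimpleGraph V} {v w : V} {l : List V}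
    (h : G.IsCycleList v l) (hw : w ∈ v :: l) :
    ∃ l', G.IsCycleList w l' ∧ (w :: l').Perm (v :: l) := by
  rcases List.mem_cons.1 hw with rfl | hw
  · exact ⟨l, h, List.Perm.refl _⟩
  · obtain ⟨l₁, l₂, rfl⟩ := List.append_of_mem hw
    exact ⟨_, h.rotate, List.perm_append_comm (l₁ := w :: l₂) (l₂ := v :: l₁)⟩

theorem IsCycleList.reverse {G : SimpleGraph V} {v : V} {l : List V}
    (h : G.IsCycleList v l) : G.IsCycleList v l.reverse := by
  obtain ⟨h1, h2, h3⟩ := h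
  refine ⟨by simpa using h1, ?_, by simpa using h3⟩
  have : v :: (l.reverse ++ [v]) = (v :: (l ++ [v])).reverse := by simp
  rw [this, List.isChain_reverse]
  exact h2.imp fun a b hab => hab.symm

theorem IsCycleList.exists_walk {G : SimpleGraph V} {v : V} {l : List V}
    (h : G.IsCycleList v l) :
    ∃ c : G.Walk v v, c.IsCycle ∧ c.support = v :: (l ++ [v]) := by
  obtain ⟨h1, h2, h3⟩ := h
  let c := Walk.ofSupport (v :: (l ++ [v])) (by simp) h2
  have hc : c.support = v :: (l ++ [v]) := Walk.support_ofSupport _ _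
  have hlast : (v :: (l ++ [v])).getLast (by simp) = v := by simp
  let c' : G.Walk v v := c.copy (by simp) hlast
  have hc' : c'.support = v :: (l ++ [v]) := (Walk.support_copy _ _ _).trans hc
  refine ⟨c', ?_, hc'⟩
  have hlen : c'.length = l.length + 1 := by
    have := c'.length_support
    simp [hc'] at this; omega
  rw [Walk.isCycle_iff_isPath_tail_and_le_length]
  refine ⟨?_, by omega⟩
  rw [Walk.isPath_def, Walk.support_tail_of_not_nil, hc']
  · rw [List.tail_cons]
    grind
  · rw [Walk.not_nil_iff_lt_length]; omega

/-- A cycle through `v` with enough further neighbours of `v` gives a keyring. -/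
theorem IsCycleList.hasKeyring [Fintype V] [DecidableEq V] {G : SimpleGraph V} [DecidableRel G.Adj]
    {v : V} {l : List V} {r k : ℕ} (h : G.IsCycleList v l)
    (hr : l.countP (G.Adj v) + r ≤ G.degree v) (hk : k ≤ l.length + 1 + r) :
    HasKeyring G r k := by
  obtain ⟨c, hc, hs⟩ := h.exists_walk
  have hlen : c.length = l.length + 1 := by
    have := c.length_support
    simp [hs] at this; omega
  have hle : r ≤ (G.neighborFinset v \ (l.filter (G.Adj v)).toFinset).card := by
    have h1 := Finset.le_card_sdiff (l.filter (G.Adj v)).toFinset (G.neighborFinset v)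
    have h2 := (l.filter (G.Adj v)).toFinset_card_le
    rw [← List.countP_eq_length_filter] at h2
    rw [G.card_neighborFinset_eq_degree] at h1
    omega
  obtain ⟨L, hL, hLr⟩ := Finset.exists_subset_card_eq hle
  refine ⟨v, c, L, hc, hLr, fun w hw => ?_, by omega⟩
  have := hL hw
  simp at this
  refine ⟨this.1, ?_⟩
  have hne := this.1.ne'
  simp [hs, hne]
  tauto

theorem HasKeyring.map {W : Type*} [DecidableEq V] [DecidableEq W] {G : SimpleGraph V}
    {H : SimpleGraph W} (f : H ↪g G) {r k : ℕ} (h : HasKeyring H r k) : HasKeyring G r k := by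
  obtain ⟨u, c, L, hc, hL, hadj, hk⟩ := h
  refine ⟨f u, c.map f.toHom, L.map f.toEmbedding, hc.map f.injective, by simpa using hL, ?_,
    by simpa using hk⟩
  intro v hv
  obtain ⟨w, hw, rfl⟩ := Finset.mem_map.1 hv
  refine ⟨f.map_adj_iff.2 (hadj w hw).1, ?_⟩
  have := (hadj w hw).2
  simpa [Walk.support_map] using this

/-- The number of ordered adjacent pairs in `A ×ˢ B`. -/
def adjCount (G : SimpleGraph V) [DecidableRel G.Adj] (A B : Finset V) : ℕ :=
  ∑ x ∈ A, ∑ y ∈ B, if G.Adj x y then 1 else 0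

section adjCount

variable (G : SimpleGraph V) [DecidableRel G.Adj]

theorem adjCount_comm (A B : Finset V) : G.adjCount A B = G.adjCount B A := by
  unfold adjCount
  rw [Finset.sum_comm]
  simp only [G.adj_comm]

theorem adjCount_union_left [DecidableEq V] {A B : Finset V} (h : Disjoint A B) (C : Finset V) :
    G.adjCount (A ∪ B) C = G.adjCount A C + G.adjCount B C :=
  Finset.sum_union h

theorem adjCount_union_right [DecidableEq V] (A : Finset V) {B C : Finset V} (h : Disjoint B C) :
    G.adjCount A (B ∪ C) = G.adjCount A B + G.adjCount A C := by
  rw [adjCount_comm, adjCount_union_left G h, adjCount_comm G B, adjCount_comm G C]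

theorem adjCount_union_self [DecidableEq V] {A B : Finset V} (h : Disjoint A B) :
    G.adjCount (A ∪ B) (A ∪ B) = G.adjCount A A + 2 * G.adjCount A B + G.adjCount B B := by
  rw [adjCount_union_left G h, adjCount_union_right G A h, adjCount_union_right G B h,
    adjCount_comm G B A]
  ring

theorem adjCount_eq_zero {A B : Finset V} (h : ∀ a ∈ A, ∀ b ∈ B, ¬ G.Adj a b) :
    G.adjCount A B = 0 :=
  Finset.sum_eq_zero fun a ha => Finset.sum_eq_zero fun b hb => if_neg (h a ha b hb)

theorem adjCount_univ_right [Fintype V] (A : Finset V) :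
    G.adjCount A univ = ∑ v ∈ A, G.degree v := by
  refine Finset.sum_congr rfl fun v _ => ?_
  rw [← Finset.card_filter, ← G.card_neighborFinset_eq_degree, G.neighborFinset_eq_filter]

theorem adjCount_right [Fintype V] [DecidableEq V] (A B : Finset V) :
    G.adjCount A B = ∑ v ∈ A, (G.neighborFinset v ∩ B).card := by
  refine Finset.sum_congr rfl fun v _ => ?_
  rw [← Finset.card_filter, G.neighborFinset_eq_filter]
  congr 1
  ext; simp [and_comm]

theorem adjCount_map {W : Type u} {H : SimpleGraph W} [DecidableRel H.Adj] (f : H ↪g G)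
    (A B : Finset W) :
    G.adjCount (A.map f.toEmbedding) (B.map f.toEmbedding) = H.adjCount A B := by
  simp only [adjCount, Finset.sum_map]
  simp

/-- Deleting vertices of `T` that each have degree plus external degree at most `c` removes few
edges. -/
theorem adjCount_univ_le [Fintype V] [DecidableEq V] {c : ℕ} (T : Finset V)
    (h : ∀ t ∈ T, G.degree t + (G.neighborFinset t \ T).card ≤ c) :
    G.adjCount univ univ ≤ G.adjCount Tᶜ Tᶜ + c * T.card := by
  have h1 := G.adjCount_union_self (disjoint_compl_right (a := T))
  have h2 := G.adjCount_union_right T (disjoint_compl_right (a := T))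
  rw [Finset.union_compl] at h1 h2
  have h3 : G.adjCount T univ + G.adjCount T Tᶜ ≤ c * T.card := by
    rw [adjCount_univ_right, adjCount_right, ← Finset.sum_add_distrib, mul_comm, ← smul_eq_mul]
    refine Finset.sum_le_card_nsmul _ _ _ fun t ht => ?_
    rw [← Finset.sdiff_eq_inter_compl]
    exact h t ht
  omega

/-- A graph with more than `φ |V|` ordered adjacent pairs has an induced subgraph minimal with
this property. -/
theorem exists_minimal_induced [Fintype V] [DecidableEq V] (φ : ℕ → ℕ)
    (h : φ (Fintype.card V) < G.adjCount univ univ) :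
    ∃ (W : Type u) (_ : Fintype W) (_ : DecidableEq W) (H : SimpleGraph W)
      (_ : DecidableRel H.Adj) (_ : H ↪g G), φ (Fintype.card W) < H.adjCount univ univ ∧
      ∀ A : Finset W, A ≠ univ → H.adjCount A A ≤ φ A.card := by
  obtain ⟨S, hS, hmin⟩ := Finset.exists_min_image
    ((univ : Finset (Finset V)).filter fun S => φ S.card < G.adjCount S S) Finset.card
    ⟨univ, by simpa using h⟩
  simp only [Finset.mem_filter, Finset.mem_univ, true_and] at hS hmin
  let f := Embedding.comap (Function.Embedding.subtype (· ∈ S)) G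
  refine ⟨S, inferInstance, inferInstance, _, inferInstance, f, ?_, fun A hA => ?_⟩
  · rw [← adjCount_map G f, Fintype.card_coe]
    convert hS <;> exact Finset.attach_map_val
  · by_contra! hlt
    rw [← adjCount_map G f, ← Finset.card_map f.toEmbedding] at hlt
    have h1 := hmin _ hlt
    rw [Finset.card_map, ← Fintype.card_coe S] at h1
    exact hA ((Finset.card_eq_iff_eq_univ A).1 (le_antisymm (Finset.card_le_univ A) h1))

end adjCount

theorem exists_lt_degree_add_of_minimal [Fintype V] [DecidableEq V] {G : SimpleGraph V}
    [DecidableRel G.Adj] {c : ℕ} (hd : c * Fintype.card V < G.adjCount univ univ)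
    (hmin : ∀ A : Finset V, A ≠ univ → G.adjCount A A ≤ c * A.card) {T : Finset V}
    (hT : T.Nonempty) : ∃ t ∈ T, c < G.degree t + (G.neighborFinset t \ T).card := by
  by_contra! hcon
  have h1 := G.adjCount_univ_le T hcon
  have h2 := hmin Tᶜ (by simpa [Finset.compl_eq_univ_iff] using hT.ne_empty)
  have h3 := Finset.card_add_card_compl T
  rw [← h3, mul_add] at hd
  omega

theorem IsCycleList.map {W : Type*} {G : SimpleGraph V} {H : SimpleGraph W} (f : H ↪g G) {v : W}
    {l : List W} (h : H.IsCycleList v l) : G.IsCycleList (f v) (l.map f) := by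
  obtain ⟨h1, h2, h3⟩ := h
  refine ⟨by simpa using h1.map f.injective, ?_, by simpa using h3⟩
  have := (List.isChain_map (R := G.Adj) f (l := v :: (l ++ [v]))).2
    (h2.imp fun a b hab => f.map_adj_iff.2 hab)
  simpa using this

/-- The vertices of `l`, in this order, form a path of `G`. -/
def IsPathList (G : SimpleGraph V) (l : List V) : Prop :=
  l.Nodup ∧ l.IsChain G.Adj

/-- If no long cycle exists, then the neighbours of the first vertex of a longest path are close
to that vertex on the path. -/
theorem IsPathList.exists_pred {G : SimpleGraph V} {K : ℕ} (hK : 3 ≤ K)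
    (hno : ∀ v l, G.IsCycleList v l → l.length + 1 < K) {v : V} {L : List V}
    (hp : G.IsPathList (v :: L)) (hmax : ∀ l, G.IsPathList l → l.length ≤ (v :: L).length)
    {w : V} (hw : G.Adj v w) :
    ∃ A t B, v :: L = A ++ t :: w :: B ∧ A.length + 3 ≤ K := by
  have hmem : w ∈ v :: L := by
    by_contra hn
    have := hmax (w :: v :: L) ⟨List.nodup_cons.2 ⟨hn, hp.1⟩,
      List.isChain_cons_cons.2 ⟨hw.symm, hp.2⟩⟩
    simp at this
  have hmem' : w ∈ L := by
    rcases List.mem_cons.1 hmem with h | h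
    · exact absurd h hw.ne'
    · exact h
  obtain ⟨X, B, rfl⟩ := List.append_of_mem hmem'
  refine ⟨(v :: X).dropLast, (v :: X).getLast (by simp), B, ?_, ?_⟩
  · conv_lhs => rw [← List.cons_append, ← List.dropLast_append_getLast (l := v :: X) (by simp)]
    simp
  · by_cases hX : X = []
    · subst hX; simpa using hK
    · have := hno v (X ++ [w]) ⟨?_, ?_, ?_⟩
      · simp at this ⊢; omega
      · have := hp.1
        grind
      · have h1 : (v :: (X ++ [w])).IsChain G.Adj := hp.2.prefix ⟨B, by simp⟩
        have := List.IsChain.append_overlap (l₁ := v :: X) (l₂ := [w]) (l₃ := [v])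
          (by simpa using h1) (by simpa using hw.symm) (by simp)
        simpa using this
      · have := List.length_pos_of_ne_nil hX
        simp; omega

theorem IsPathList.neighborFinset_subset [Fintype V] [DecidableEq V] {G : SimpleGraph V}
    [DecidableRel G.Adj] {K : ℕ} (hK : 3 ≤ K)
    (hno : ∀ v l, G.IsCycleList v l → l.length + 1 < K) {v : V} {L : List V}
    (hp : G.IsPathList (v :: L)) (hmax : ∀ l, G.IsPathList l → l.length ≤ (v :: L).length) :
    G.neighborFinset v ⊆ ((v :: L).take (K - 1)).toFinset := by
  intro w hw
  rw [mem_neighborFinset] at hw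
  obtain ⟨A, t, B, h, hA⟩ := hp.exists_pred hK hno hmax hw
  rw [h, List.mem_toFinset, show A ++ t :: w :: B = (A ++ [t, w]) ++ B by simp,
    List.take_append, List.take_of_length_le (by simp; omega)]
  simp

/-- Rotating a path at a neighbour `w` of its first vertex. -/
theorem IsPathList.rotate {G : SimpleGraph V} {v t w : V} {L A B : List V}
    (hp : G.IsPathList (v :: L)) (hw : G.Adj v w) (h : v :: L = A ++ t :: w :: B) :
    G.IsPathList (t :: (A.reverse ++ w :: B)) := by
  have e : t :: (A.reverse ++ w :: B) = (A ++ [t]).reverse ++ w :: B := by simp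
  have e' : A ++ t :: w :: B = (A ++ [t]) ++ w :: B := by simp
  unfold IsPathList at *
  rw [h] at hp
  constructor
  · rw [e]
    rw [e'] at hp
    exact (((List.reverse_perm (A ++ [t])).append_right _).nodup_iff).2 hp.1
  · rw [e]
    rw [e'] at hp
    refine List.IsChain.append ?_ hp.2.right_of_append ?_
    · rw [List.isChain_reverse]
      exact hp.2.left_of_append.imp fun a b hab => hab.symm
    · intro x hx y hy
      rw [List.getLast?_reverse] at hx
      have hv : (A ++ [t]).head? = some v := by
        cases A <;> grind
      simp only [hv, List.head?_cons, Option.mem_def, Option.some.injEq] at hx hy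
      exact hx ▸ hy ▸ hw

theorem _root_.List.Nodup.eq_of_append_cons {α : Type*} {A B A' B' : List α} {t : α}
    (h : (A ++ t :: B).Nodup) (h' : A ++ t :: B = A' ++ t :: B') : B = B' := by
  induction A generalizing A' with
  | nil => cases A' <;> grind
  | cons a A ih => cases A' <;> grind

theorem exists_isCycleList_of_minimal [Fintype V] [DecidableEq V] {G : SimpleGraph V}
    [DecidableRel G.Adj] {K : ℕ} (hK : 3 ≤ K)
    (hd : (K - 1) * Fintype.card V < G.adjCount univ univ)
    (hmin : ∀ A : Finset V, A ≠ univ → G.adjCount A A ≤ (K - 1) * A.card) :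
    ∃ v l, G.IsCycleList v l ∧ K ≤ l.length + 1 := by
  by_contra! hno
  set N := Fintype.card V with hN
  have hdeg : ∀ v, G.degree v < N + 1 := fun v => (G.degree_lt_card_verts v).trans_le (by omega)
  obtain ⟨x, y, hxy⟩ : ∃ x y, G.Adj x y := by
    by_contra! hcon
    rw [G.adjCount_eq_zero fun a _ b _ => hcon a b] at hd
    omega
  -- a longest path whose first vertex has maximal degree
  obtain ⟨v, L, hp, hbest⟩ : ∃ v L, G.IsPathList (v :: L) ∧ ∀ v' L', G.IsPathList (v' :: L') →
      L'.length * (N + 1) + G.degree v' ≤ L.length * (N + 1) + G.degree v := by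
    let S : Set ℕ := {m | ∃ v L, G.IsPathList (v :: L) ∧ m = L.length * (N + 1) + G.degree v}
    have hne : S.Nonempty := ⟨_, x, [], ⟨by simp, by simp⟩, rfl⟩
    have hbdd : BddAbove S := by
      refine ⟨N * (N + 1) + N, ?_⟩
      rintro _ ⟨v, L, h, rfl⟩
      have h1 := h.1.length_le_card
      have h2 := hdeg v
      rw [← hN, List.length_cons] at h1
      exact Nat.add_le_add (Nat.mul_le_mul_right _ (by omega)) (by omega)
    obtain ⟨v, L, h, hS⟩ := Nat.sSup_mem hne hbdd
    exact ⟨v, L, h, fun v' L' h' => hS ▸ le_csSup hbdd ⟨v', L', h', rfl⟩⟩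
  have hmax : ∀ l, G.IsPathList l → l.length ≤ (v :: L).length := by
    rintro (_ | ⟨v', L'⟩) h
    · simp
    · have h1 := hbest _ _ h
      have h2 := hdeg v
      simp only [List.length_cons]
      by_contra! h3
      nlinarith
  have hmaxdeg : ∀ v' L', G.IsPathList (v' :: L') → L'.length = L.length →
      G.degree v' ≤ G.degree v := by
    intro v' L' h h'
    have := hbest _ _ h
    rw [h'] at this
    omega
  have hpos : 0 < G.degree v := by
    have h1 := hmax [x, y] ⟨by simpa using hxy.ne, by simpa using hxy⟩
    rw [G.degree_pos_iff_exists_adj]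
    rcases L with _ | ⟨z, L⟩
    · simp at h1
    · exact ⟨z, (List.isChain_cons_cons.1 hp.2).1⟩
  have hpred : ∀ w : G.neighborFinset v, ∃ t A B, v :: L = A ++ t :: w.1 :: B ∧
      A.length + 3 ≤ K := by
    rintro ⟨w, hw⟩
    obtain ⟨A, t, B, h⟩ := hp.exists_pred hK hno hmax ((mem_neighborFinset ..).1 hw)
    exact ⟨t, A, B, h⟩
  choose pred hpred using hpred
  have hinj : Function.Injective pred := by
    intro w w' hww
    obtain ⟨A, B, h, -⟩ := hpred w
    obtain ⟨A', B', h', -⟩ := hpred w'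
    have h1 := List.Nodup.eq_of_append_cons (h ▸ hp.1) (h.symm.trans (hww ▸ h'))
    exact Subtype.ext (List.cons.inj h1).1
  set T : Finset V := univ.image pred with hT
  have hTcard : T.card = G.degree v := by
    rw [hT, Finset.card_image_of_injective _ hinj, Finset.card_univ, Fintype.card_coe,
      card_neighborFinset_eq_degree]
  set W := ((v :: L).take (K - 1)).toFinset with hW
  have hWcard : W.card ≤ K - 1 :=
    (List.toFinset_card_le _).trans (List.length_take_le _ _)
  have hTW : T ⊆ W := by
    intro t ht
    obtain ⟨w, -, rfl⟩ := Finset.mem_image.1 ht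
    obtain ⟨A, B, h, hA⟩ := hpred w
    rw [hW, h, List.mem_toFinset,
      show A ++ pred w :: w.1 :: B = (A ++ [pred w]) ++ w.1 :: B by simp, List.take_append, List.take_of_length_le (by simp; omega)]
    simp
  obtain ⟨t, ht, hlt⟩ := exists_lt_degree_add_of_minimal hd hmin (T := T)
    (Finset.card_pos.1 (by omega))
  obtain ⟨w, -, rfl⟩ := Finset.mem_image.1 ht
  obtain ⟨A, B, h, hA⟩ := hpred w
  have hrot := hp.rotate ((mem_neighborFinset ..).1 w.2) h
  have hlen : (A.reverse ++ w.1 :: B).length = L.length := by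
    have := congrArg List.length h
    simp at this ⊢
    omega
  have h1 := hmaxdeg _ _ hrot hlen
  have h2 := hrot.neighborFinset_subset hK hno (by simpa [hlen] using hmax)
  have h3 : ((pred w :: (A.reverse ++ w.1 :: B)).take (K - 1)).toFinset = W := by
    have e1 : pred w :: (A.reverse ++ w.1 :: B) = (A ++ [pred w]).reverse ++ w.1 :: B := by simp
    have e2 : v :: L = (A ++ [pred w]) ++ w.1 :: B := by simp [h]
    have h5 : (A ++ [pred w]).length ≤ K - 1 := by simp; omega
    rw [hW, e1, e2, List.take_append, List.take_append (l₁ := A ++ [pred w]),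
      List.take_of_length_le h5, List.take_of_length_le (by rwa [List.length_reverse]),
      List.toFinset_append, List.toFinset_append, List.toFinset_reverse, List.length_reverse]
  rw [h3] at h2
  have h4 := Finset.card_le_card (Finset.sdiff_subset_sdiff h2 (Finset.Subset.refl T))
  rw [Finset.card_sdiff_of_subset hTW] at h4
  have h5 := Finset.card_le_card hTW
  omega

/-- **Erdős–Gallai** theorem for cycles. -/
theorem exists_isCycleList [Fintype V] [DecidableEq V] {G : SimpleGraph V}
    [DecidableRel G.Adj] {K : ℕ} (hK : 3 ≤ K)
    (hd : (K - 1) * Fintype.card V < G.adjCount univ univ) :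
    ∃ v l, G.IsCycleList v l ∧ K ≤ l.length + 1 := by
  obtain ⟨W, _, _, H, _, f, hd, hmin⟩ := G.exists_minimal_induced (fun n => (K - 1) * n) hd
  obtain ⟨v, l, h, hl⟩ := exists_isCycleList_of_minimal hK hd hmin
  exact ⟨_, _, h.map f, by simpa using hl⟩

theorem _root_.List.exists_eq_append_cons_of_lt_countP {α : Type*} {p : α → Bool} {l : List α}
    {s : ℕ} (h : s < l.countP p) :
    ∃ A x B, l = A ++ x :: B ∧ p x ∧ A.countP p = s := by
  induction l generalizing s with
  | nil => simp at h
  | cons a l ih =>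
    by_cases ha : p a
    · rw [List.countP_cons_of_pos ha] at h
      rcases s with _ | s
      · exact ⟨[], a, l, rfl, ha, rfl⟩
      · obtain ⟨A, x, B, rfl, hx, hA⟩ := ih (s := s) (by omega)
        exact ⟨a :: A, x, B, rfl, hx, by rw [List.countP_cons_of_pos ha, hA]⟩
    · rw [List.countP_cons_of_neg ha] at h
      obtain ⟨A, x, B, rfl, hx, hA⟩ := ih h
      exact ⟨a :: A, x, B, rfl, hx, by rw [List.countP_cons_of_neg ha, hA]⟩

theorem _root_.List.countP_le_add_of_prefix_of_suffix {α : Type*} (p : α → Bool) {A C l : List α}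
    (hA : A <+: l) (hC : C <:+ l) :
    l.countP p ≤ A.countP p + C.countP p + (l.length - A.length - C.length) := by
  obtain ⟨E, rfl⟩ := hA
  obtain ⟨F, hF⟩ := hC
  rcases List.append_eq_append_iff.1 hF with ⟨M, rfl, rfl⟩ | ⟨M, rfl, rfl⟩
  · simp only [List.countP_append]
    omega
  · have := List.countP_le_length (p := p) (l := M)
    simp only [List.countP_append, List.length_append]
    omega

theorem IsCycleList.of_append {G : SimpleGraph V} {v x : V} {A B : List V}
    (h : G.IsCycleList v (A ++ x :: B)) (hx : G.Adj v x) (hB : 1 ≤ B.length) :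
    G.IsCycleList v (x :: B) := by
  obtain ⟨h1, h2, -⟩ := h
  refine ⟨?_, ?_, by simpa using hB⟩
  · exact h1.sublist ((List.sublist_append_right A (x :: B)).cons_cons v)
  · have : (x :: (B ++ [v])).IsChain G.Adj := h2.suffix ⟨v :: A, by simp⟩
    exact List.isChain_cons_cons.2 ⟨hx, this⟩

/-- If a cycle through `v` has too many neighbours of `v` for a keyring, then shortcutting it by
a chord at `v` shows that only a short final segment remains. -/
theorem IsCycleList.exists_short_tail [Fintype V] [DecidableEq V] {G : SimpleGraph V}
    [DecidableRel G.Adj] {v : V} {L : List V} {r k s : ℕ} (h : G.IsCycleList v L)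
    (hno : ¬ HasKeyring G r k) (hs : L.countP (G.Adj v) + r = G.degree v + s)
    (hs2 : s + 2 ≤ L.countP (G.Adj v)) :
    ∃ A, A <+: L ∧ A.countP (G.Adj v) = s ∧ L.length + r + 2 ≤ A.length + k := by
  obtain ⟨A, x, B, rfl, hx, hA⟩ := List.exists_eq_append_cons_of_lt_countP
    (p := fun w => decide (G.Adj v w)) (l := L) (s := s) (by omega)
  refine ⟨A, List.prefix_append _ _, hA, ?_⟩
  rw [List.countP_append, hA] at hs hs2
  have hlen := List.countP_le_length (p := fun w => decide (G.Adj v w)) (l := x :: B)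
  rw [List.length_cons] at hlen
  by_contra! hlt
  refine hno ((h.of_append (of_decide_eq_true hx) (by omega)).hasKeyring (by omega) ?_)
  simp at hlt ⊢
  omega

/-- A cycle of length at least `k` through a vertex whose degree plus number of neighbours outside
the cycle is at least `k` gives a keyring with few leaves. -/
theorem IsCycleList.hasKeyring_of_two_mul_lt [Fintype V] [DecidableEq V] {G : SimpleGraph V}
    [DecidableRel G.Adj] {v : V} {L : List V} {r k : ℕ} (h : G.IsCycleList v L) (hrk : 2 * r < k)
    (hk : k ≤ L.length + 1) (hd : k + L.countP (G.Adj v) ≤ 2 * G.degree v) :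
    HasKeyring G r k := by
  by_contra hno
  by_cases hle : L.countP (G.Adj v) + r ≤ G.degree v
  · exact hno (h.hasKeyring hle (by omega))
  push Not at hle
  obtain ⟨s, hs⟩ := Nat.exists_eq_add_of_lt hle
  obtain ⟨A, hA, hAs, hAk⟩ := h.exists_short_tail (s := s + 1) hno (by omega) (by omega)
  obtain ⟨C, hC, hCs, hCk⟩ := h.reverse.exists_short_tail (s := s + 1) hno
    (by rw [List.countP_reverse]; omega) (by rw [List.countP_reverse]; omega)
  have := List.countP_le_add_of_prefix_of_suffix (fun w => decide (G.Adj v w)) hA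
    (C := C.reverse) (by rwa [← List.reverse_prefix, List.reverse_reverse])
  rw [List.length_reverse] at hCk
  rw [List.countP_reverse, List.length_reverse] at this
  omega

/-- Few leaves: Sidorenko's theorem. -/
theorem hasKeyring_of_two_mul_lt [Fintype V] [DecidableEq V] {G : SimpleGraph V}
    [DecidableRel G.Adj] {r k : ℕ} (hk : 3 ≤ k) (hrk : 2 * r < k)
    (hd : (k - 1) * Fintype.card V < G.adjCount univ univ) : HasKeyring G r k := by
  obtain ⟨W, _, _, H, _, f, hd, hmin⟩ := G.exists_minimal_induced (fun n => (k - 1) * n) hd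
  refine HasKeyring.map f ?_
  obtain ⟨v, l, h, hl⟩ := exists_isCycleList hk hd
  obtain ⟨t, ht, hlt⟩ := exists_lt_degree_add_of_minimal hd hmin (T := (v :: l).toFinset)
    ⟨v, by simp⟩
  obtain ⟨L, hL, hperm⟩ := h.exists_rotate (List.mem_toFinset.1 ht)
  have hlen := hperm.length_eq
  rw [List.length_cons, List.length_cons] at hlen
  refine hL.hasKeyring_of_two_mul_lt hrk (by omega) ?_
  have h1 : L.countP (H.Adj t) ≤ (H.neighborFinset t ∩ (v :: l).toFinset).card := by
    rw [List.countP_eq_length_filter, ← List.toFinset_card_of_nodup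
      ((List.nodup_cons.1 hL.nodup).2.filter _)]
    refine Finset.card_le_card fun w hw => ?_
    simp only [List.mem_toFinset, List.mem_filter, decide_eq_true_eq] at hw
    rw [Finset.mem_inter, mem_neighborFinset, List.mem_toFinset, ← hperm.mem_iff]
    exact ⟨hw.2, List.mem_cons_of_mem _ hw.1⟩
  have h2 := Finset.card_inter_add_card_sdiff (H.neighborFinset t) (v :: l).toFinset
  rw [H.card_neighborFinset_eq_degree] at h2
  omega

/-- A long enough cycle through a vertex of large degree gives a keyring. -/
theorem IsCycleList.hasKeyring_of_le_degree [Fintype V] [DecidableEq V] {G : SimpleGraph V}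
    [DecidableRel G.Adj] {v : V} {L : List V} {r k : ℕ} (h : G.IsCycleList v L) (hrk : r + 3 ≤ k)
    (hk : k ≤ L.length + 1 + r) (hd : k ≤ G.degree v + 1) : HasKeyring G r k := by
  obtain ⟨P, Q, rfl, hP⟩ : ∃ P Q, L = P ++ Q ∧ P.length = k - r - 2 :=
    ⟨_, _, (List.take_append_drop (k - r - 2) L).symm, by rw [List.length_take]; omega⟩
  rw [List.length_append] at hk
  have hQ : Q ≠ [] := by
    rintro rfl
    simp at hk
    omega
  have hlast : G.Adj v (Q.getLast hQ) := by
    have h1 : v :: (P ++ Q ++ [v]) = (v :: (P ++ Q.dropLast)) ++ [Q.getLast hQ, v] := by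
      conv_lhs => rw [← List.dropLast_append_getLast hQ]
      simp
    have h2 := h.chain
    rw [h1] at h2
    exact (List.isChain_pair.1 h2.right_of_append).symm
  obtain ⟨A, x, B, rfl, hx, hA⟩ := List.exists_eq_append_cons_of_lt_countP
    (p := fun w => decide (G.Adj v w)) (l := Q) (s := 0)
    (List.countP_pos_iff.2 ⟨_, List.getLast_mem hQ, by simpa using hlast⟩)
  have hx' : G.Adj v x := of_decide_eq_true hx
  have hc : G.IsCycleList v (P ++ (A ++ [x])) := by
    refine ⟨?_, ?_, by simp; omega⟩
    · refine h.nodup.sublist (List.IsPrefix.sublist ⟨B, by simp⟩)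
    · have h1 : (v :: (P ++ (A ++ [x]))).IsChain G.Adj := h.chain.prefix ⟨B ++ [v], by simp⟩
      have := List.IsChain.append_overlap (l₁ := v :: (P ++ A)) (l₂ := [x]) (l₃ := [v])
        (by simpa using h1) (by simpa using hx'.symm) (by simp)
      simpa using this
  refine hc.hasKeyring ?_ (by simp; omega)
  have h1 := List.countP_le_length (p := fun w => decide (G.Adj v w)) (l := P)
  have h2 := List.countP_le_length (p := fun w => decide (G.Adj v w)) (l := [x])
  rw [List.countP_append, List.countP_append, hA]
  rw [List.length_singleton] at h2
  omega

theorem IsPathList.reverse {G : SimpleGraph V} {l : List V} (h : G.IsPathList l) :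
    G.IsPathList l.reverse := by
  refine ⟨List.nodup_reverse.2 h.1, ?_⟩
  rw [List.isChain_reverse]
  exact h.2.imp fun a b hab => hab.symm

/-- No vertex separates `G`. -/
def NoCutVertex (G : SimpleGraph V) : Prop :=
  ∀ (w : V) (A : Set V), A.Nonempty → w ∉ A → (∃ b, b ∉ A ∧ b ≠ w) →
    ∃ a ∈ A, ∃ b, b ∉ A ∧ b ≠ w ∧ G.Adj a b

theorem NoCutVertex.exists_path {G : SimpleGraph V} (hG : G.NoCutVertex) {w u : V} {X : Set V}
    (hX : X.Nonempty) (hwX : w ∉ X) (huX : u ∉ X) (huw : u ≠ w) :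
    ∃ h R, G.IsPathList (h :: (R ++ [u])) ∧ h ∈ X ∧ ∀ y ∈ R ++ [u], y ∉ X ∧ y ≠ w := by
  let S : Set V := {v | ∃ l, G.IsPathList l ∧ l.head? = some v ∧ l.getLast? = some u ∧
    ∀ y ∈ l, y ∉ X ∧ y ≠ w}
  have hS : ∀ v ∈ S, v ∉ X ∧ v ≠ w := by
    rintro v ⟨l, -, hv, -, hl⟩
    exact hl v (List.mem_of_head? hv)
  have huS : u ∈ S := ⟨[u], ⟨by simp, by simp⟩, by simp, by simp, by simp [huX, huw]⟩
  obtain ⟨x, hx⟩ := hX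
  obtain ⟨a, ⟨l, hl, hla, hlu, hlX⟩, b, hbS, hbw, hab⟩ := hG w S ⟨u, huS⟩ (fun h => (hS w h).2 rfl)
    ⟨x, fun h => (hS x h).1 hx, fun h => hwX (h ▸ hx)⟩
  obtain ⟨R, rfl⟩ : ∃ R, l = R ++ [u] := by
    obtain ⟨R, hR⟩ := List.getLast?_eq_some_iff.1 hlu
    exact ⟨R, hR⟩
  have hcons : b ∉ R ++ [u] → G.IsPathList (b :: (R ++ [u])) := fun hb =>
    ⟨List.nodup_cons.2 ⟨hb, hl.1⟩, List.isChain_cons.2 ⟨fun y hy => by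
      rw [hla] at hy
      obtain rfl : a = y := by simpa using hy
      exact hab.symm, hl.2⟩⟩
  by_cases hbX : b ∈ X
  · exact ⟨b, R, hcons fun hb => (hlX b hb).1 hbX, hbX, hlX⟩
  · exfalso
    apply hbS
    by_cases hb : b ∈ R ++ [u]
    · obtain ⟨l₁, l₂, he⟩ := List.append_of_mem hb
      rw [he] at hl hlu hlX
      refine ⟨b :: l₂, ⟨hl.1.sublist (List.sublist_append_right ..), hl.2.right_of_append⟩, rfl, ?_,
        fun y hy => hlX y (List.mem_append_right _ hy)⟩
      simpa using hlu
    · refine ⟨_, hcons hb, rfl, by simp [List.getLast?_cons], ?_⟩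
      intro y hy
      rcases List.mem_cons.1 hy with rfl | hy
      · exact ⟨hbX, hbw⟩
      · exact hlX y hy

/-- A path joining two distinct vertices of `C` with inner vertices `e` outside `C`. -/
structure IsEar (G : SimpleGraph V) (C : Set V) (c : V) (e : List V) (c' : V) : Prop where
  left_mem : c ∈ C
  right_mem : c' ∈ C
  path : G.IsPathList (c :: (e ++ [c']))
  notMem : ∀ y ∈ e, y ∉ C

theorem IsEar.reverse {G : SimpleGraph V} {C : Set V} {c c' : V} {e : List V}
    (h : G.IsEar C c e c') : G.IsEar C c' e.reverse c := by
  refine ⟨h.right_mem, h.left_mem, ?_, by simpa using h.notMem⟩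
  have := h.path.reverse
  simpa using this

theorem IsPathList.append {G : SimpleGraph V} {l l' : List V} {x y : V}
    (h : G.IsPathList (l ++ [x])) (h' : G.IsPathList (y :: l')) (hxy : G.Adj x y)
    (hd : ∀ a ∈ l ++ [x], a ∉ y :: l') : G.IsPathList (l ++ [x] ++ y :: l') := by
  refine ⟨List.Nodup.append h.1 h'.1 fun a ha => hd a ha, h.2.append h'.2 ?_⟩
  simpa using hxy

/-- Rerouting an ear through a further path. -/
theorem IsEar.exists_of_path {G : SimpleGraph V} {C : Set V} {c c' w u h : V} {e₁ e₂ R : List V}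
    (he : G.IsEar C c (e₁ ++ w :: e₂) c') (hwu : G.Adj w u) (hp : G.IsPathList (h :: (R ++ [u])))
    (hR : ∀ y ∈ R ++ [u], y ∉ C ∧ y ∉ e₁ ++ w :: e₂) (hh : (h ∈ C ∧ h ≠ c) ∨ h ∈ e₁) :
    ∃ c e c', G.IsEar C c e c' ∧ u ∈ e := by
  obtain ⟨hc, hc', hpath, hmem⟩ := he
  rcases hh with ⟨hhC, hhc⟩ | hh
  · refine ⟨c, e₁ ++ w :: (R ++ [u]).reverse, h, ⟨hc, hhC, ?_, ?_⟩, by simp⟩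
    · have h1 : G.IsPathList ((c :: e₁) ++ [w]) :=
        ⟨hpath.1.sublist (List.IsPrefix.sublist ⟨e₂ ++ [c'], by simp⟩),
          hpath.2.prefix ⟨e₂ ++ [c'], by simp⟩⟩
      have h2 : G.IsPathList (u :: (R.reverse ++ [h])) := by simpa using hp.reverse
      have := h1.append h2 hwu (by grind)
      simpa using this
    · grind
  · obtain ⟨f₁, f₂, rfl⟩ := List.append_of_mem hh
    refine ⟨c, f₁ ++ h :: (R ++ [u]) ++ w :: e₂, c', ⟨hc, hc', ?_, ?_⟩, by simp⟩
    · have h1 : G.IsPathList ((c :: f₁) ++ [h]) :=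
        ⟨hpath.1.sublist (List.IsPrefix.sublist ⟨f₂ ++ w :: (e₂ ++ [c']), by simp⟩),
          hpath.2.prefix ⟨f₂ ++ w :: (e₂ ++ [c']), by simp⟩⟩
      have h2 : G.IsPathList (w :: (e₂ ++ [c'])) :=
        ⟨hpath.1.sublist (List.IsSuffix.sublist ⟨c :: (f₁ ++ h :: f₂), by simp⟩),
          hpath.2.suffix ⟨c :: (f₁ ++ h :: f₂), by simp⟩⟩
      have hn : ((c :: f₁) ++ h :: (f₂ ++ w :: (e₂ ++ [c']))).Nodup := by simpa using hpath.1
      have hn1 := List.nodup_append.1 hn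
      have hn2 := List.nodup_cons.1 hn1.2.1
      have hhw : h ∉ w :: (e₂ ++ [c']) := fun hm => hn2.1 (List.mem_append_right _ hm)
      have hRw : ∀ y ∈ R ++ [u], y ∉ w :: (e₂ ++ [c']) := by grind
      have hRf : ∀ y ∈ R ++ [u], y ∉ c :: f₁ := by grind
      have hd : ∀ a ∈ h :: R ++ [u], a ∉ w :: (e₂ ++ [c']) := by
        intro a ha
        rcases List.mem_cons.1 ha with rfl | ha
        · exact hhw
        · exact hRw a ha
      have h3 := IsPathList.append (l := h :: R) (by simpa using hp) h2 hwu.symm hd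
      have h4 : G.IsPathList ((c :: f₁) ++ h :: (R ++ [u] ++ w :: (e₂ ++ [c']))) := by
        refine ⟨?_, List.IsChain.append_overlap (l₁ := c :: f₁) (l₂ := [h])
          (l₃ := R ++ [u] ++ w :: (e₂ ++ [c'])) h1.2 (by simpa using h3.2) (by simp)
          |> fun H => by simpa using H⟩
        refine List.Nodup.append hn1.1 (by simpa using h3.1) fun a ha hb => ?_
        have hb' : a ∈ h :: (R ++ [u]) ∨ a ∈ w :: (e₂ ++ [c']) := by
          simpa [or_assoc] using hb
        rcases hb' with hb' | hb'
        · rcases List.mem_cons.1 hb' with rfl | hb'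
          · exact hn1.2.2 a ha a (by simp) rfl
          · exact hRf a hb' ha
        · exact hn1.2.2 a ha a (List.mem_cons_of_mem _ (List.mem_append_right _ hb')) rfl
      simpa using h4
    · grind

/-- Ear decomposition: in a graph without cut vertices, each vertex outside `C` is on an ear. -/
theorem NoCutVertex.exists_isEar {G : SimpleGraph V} (hG : G.NoCutVertex) {C : Set V}
    (hC : C.Nontrivial) {u : V} (hu : u ∉ C) : ∃ c e c', G.IsEar C c e c' ∧ u ∈ e := by
  let A : Set V := {v | v ∈ C ∨ ∃ c e c', G.IsEar C c e c' ∧ v ∈ e}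
  have hCA : C ⊆ A := fun v hv => Or.inl hv
  by_contra hcon
  have huA : u ∉ A := fun h => h.elim hu hcon
  obtain ⟨w₀, hw₀⟩ := hC.nonempty
  obtain ⟨x, hx, hxw⟩ := hC.exists_ne w₀
  obtain ⟨w, ⟨hwA, -⟩, v, hv, hvw, hwv⟩ := hG w₀ (A \ {w₀}) ⟨x, hCA hx, hxw⟩ (by simp)
    ⟨u, fun h => huA h.1, fun h => hu (h ▸ hw₀)⟩
  have hvA : v ∉ A := fun h => hv ⟨h, hvw⟩
  apply hvA
  right
  rcases hwA with hwC | ⟨c, e, c', he, hwe⟩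
  · obtain ⟨y, hy, hyw⟩ := hC.exists_ne w
    obtain ⟨h, R, hp, hh, hR⟩ := hG.exists_path (w := w) (u := v) (X := C \ {w}) ⟨y, hy, hyw⟩
      (by simp) (fun h => hvA (hCA h.1)) hwv.ne'
    have hRC : ∀ y ∈ R ++ [v], y ∉ C := fun y hy hyC => (hR y hy).1 ⟨hyC, (hR y hy).2⟩
    refine ⟨h, R ++ [v], w, ⟨hh.1, hwC, ?_, hRC⟩, by simp⟩
    have := IsPathList.append (l := h :: R) (y := w) (l' := []) (by simpa using hp)
      ⟨by simp, by simp⟩ hwv.symm (by have := hh.2; grind)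
    simpa using this
  · have hwC := he.notMem w hwe
    have hve : v ∉ e := fun h => hvA (Or.inr ⟨c, e, c', he, h⟩)
    obtain ⟨h, R, hp, hh, hR⟩ := hG.exists_path (w := w) (u := v) (X := (C ∪ {y | y ∈ e}) \ {w})
      ⟨c, Or.inl he.left_mem, fun h => hwC (h ▸ he.left_mem)⟩ (by simp)
      (fun h => h.1.elim (fun h => hvA (hCA h)) hve) hwv.ne'
    have hRC : ∀ y ∈ R ++ [v], y ∉ C ∧ y ∉ e := fun y hy =>
      ⟨fun hyC => (hR y hy).1 ⟨Or.inl hyC, (hR y hy).2⟩,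
        fun hye => (hR y hy).1 ⟨Or.inr hye, (hR y hy).2⟩⟩
    have hcc : c ≠ c' := by
      have := he.path.1
      grind
    obtain ⟨e₁, e₂, rfl⟩ := List.append_of_mem hwe
    have key : ((h ∈ C ∧ h ≠ c) ∨ h ∈ e₁) ∨ ((h ∈ C ∧ h ≠ c') ∨ h ∈ e₂.reverse) := by
      have h1 := hh.1
      have h2 : h ≠ w := hh.2
      simp only [Set.mem_union, Set.mem_ofPred_eq, List.mem_append, List.mem_cons] at h1
      grind
    rcases key with key | key
    · exact he.exists_of_path hwv hp hRC key
    · have he' : G.IsEar C c' (e₂.reverse ++ w :: e₁.reverse) c := by simpa using he.reverse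
      exact he'.exists_of_path hwv hp
        (by simpa [or_comm, and_comm, or_left_comm, or_assoc] using hRC) key

theorem IsEar.isCycleList {G : SimpleGraph V} {C : Set V} {c c' : V} {e X Y : List V}
    (he : G.IsEar C c e c') (h : G.IsCycleList c (X ++ c' :: Y)) (hC : ∀ y ∈ X, y ∈ C)
    (hne : e ≠ []) : G.IsCycleList c (X ++ c' :: e.reverse) := by
  have hlen := List.length_pos_of_ne_nil hne
  refine ⟨?_, ?_, by simp; omega⟩
  · have h1 := he.path.1
    have h2 := h.nodup
    have h3 := he.notMem
    have h4 : (c :: (X ++ [c'])).Nodup := h2.sublist (List.IsPrefix.sublist ⟨Y, by simp⟩)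
    have h5 : (e.reverse).Nodup := List.nodup_reverse.2 (by grind)
    have : c :: (X ++ c' :: e.reverse) = c :: (X ++ [c']) ++ e.reverse := by simp
    rw [this]
    refine List.Nodup.append h4 h5 ?_
    intro a ha ha'
    rw [List.mem_reverse] at ha'
    grind
  · have h1 : (c :: (X ++ [c'])).IsChain G.Adj := h.chain.prefix ⟨Y ++ [c], by simp⟩
    have h2 := he.reverse.path.2
    have := List.IsChain.append_overlap (l₁ := c :: X) (l₂ := [c']) (l₃ := e.reverse ++ [c])
      (by simpa using h1) (by simpa using h2) (by simp)
    simpa using this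

/-- In a graph without cut vertices, a long cycle yields a cycle of at least half its length
through any given vertex. -/
theorem NoCutVertex.exists_isCycleList {G : SimpleGraph V} (hG : G.NoCutVertex) {v u : V}
    {l : List V} (h : G.IsCycleList v l) :
    ∃ L, G.IsCycleList u L ∧ l.length + 4 ≤ 2 * (L.length + 1) := by
  have h2 := h.two_le
  by_cases hu : u ∈ v :: l
  · obtain ⟨L, hL, hperm⟩ := h.exists_rotate hu
    have hlen := hperm.length_eq
    simp only [List.length_cons] at hlen
    exact ⟨L, hL, by omega⟩
  obtain ⟨c, e, c', he, hue⟩ := hG.exists_isEar (C := {y | y ∈ v :: l}) (u := u) (by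
    obtain _ | ⟨x, l⟩ := l
    · simp at h2
    · refine ⟨v, by simp, x, by simp, ?_⟩
      have := h.nodup
      grind) hu
  have hne : e ≠ [] := List.ne_nil_of_mem hue
  have hepos := List.length_pos_of_ne_nil hne
  obtain ⟨L, hL, hperm⟩ := h.exists_rotate he.left_mem
  have hcc : c' ≠ c := by
    have := he.path.1
    grind
  obtain ⟨X, Y, rfl⟩ := List.append_of_mem ((List.mem_cons.1
    (hperm.mem_iff.2 he.right_mem)).resolve_left hcc)
  have hlen := hperm.length_eq
  simp only [List.length_cons, List.length_append] at hlen
  have hmem : ∀ y ∈ c :: (X ++ c' :: Y), y ∈ v :: l := fun y hy => hperm.mem_iff.1 hy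
  have hc1 := he.isCycleList hL (fun y hy => hmem y (by simp [hy])) hne
  have hc2 := he.reverse.isCycleList hL.rotate (fun y hy => hmem y (by simp [hy]))
    (by simpa using hne)
  rw [List.reverse_reverse] at hc2
  rcases le_total X.length Y.length with hXY | hXY
  · obtain ⟨L, hL', hperm'⟩ := hc2.exists_rotate (w := u) (by simp [hue])
    have hlen' := hperm'.length_eq
    simp only [List.length_cons, List.length_append] at hlen'
    exact ⟨L, hL', by omega⟩
  · obtain ⟨L, hL', hperm'⟩ := hc1.exists_rotate (w := u) (by simp [hue])
    have hlen' := hperm'.length_eq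
    simp only [List.length_cons, List.length_append, List.length_reverse] at hlen'
    exact ⟨L, hL', by omega⟩

theorem noCutVertex_of_minimal [Fintype V] [DecidableEq V] {G : SimpleGraph V}
    [DecidableRel G.Adj] {m : ℕ} (hd : m * (Fintype.card V - 1) < G.adjCount univ univ)
    (hmin : ∀ A : Finset V, A ≠ univ → G.adjCount A A ≤ m * (A.card - 1)) : G.NoCutVertex := by
  classical
  rintro w S ⟨a, ha⟩ hw ⟨b, hb, hbw⟩
  by_contra! hcon
  set A := S.toFinset with hA
  set B := (insert w A)ᶜ with hB
  have hAB : G.adjCount A B = 0 := G.adjCount_eq_zero fun x hx y hy => by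
    simp [hA, hB] at hx hy
    exact hcon x hx y hy.2 hy.1
  have hwA : Disjoint A {w} := by simpa [hA] using hw
  have hwB : Disjoint B {w} := by simp [hB]
  have hAwB : Disjoint (A ∪ {w}) B := by
    rw [hB, Finset.insert_eq, Finset.union_comm]
    exact disjoint_compl_right
  have huniv : (A ∪ {w}) ∪ B = univ := by
    rw [hB, Finset.insert_eq, Finset.union_comm A, Finset.union_compl]
  have h1 := G.adjCount_union_self hwA
  have h2 := G.adjCount_union_self hwB
  have h3 := G.adjCount_union_self hAwB
  rw [huniv, G.adjCount_union_left hwA B, hAB, G.adjCount_comm {w} B] at h3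
  have h4 := hmin (A ∪ {w}) fun h => by
    have := h ▸ Finset.mem_univ b
    simp [hA, hb, hbw] at this
  have h5 := hmin (B ∪ {w}) fun h => by
    have h6 := h ▸ Finset.mem_univ a
    simp [hA, hB, ha] at h6
    exact hw (h6 ▸ ha)
  rw [Finset.card_union_of_disjoint hwA, Finset.card_singleton, Nat.add_sub_cancel] at h4
  rw [Finset.card_union_of_disjoint hwB, Finset.card_singleton, Nat.add_sub_cancel] at h5
  have h6 : Fintype.card V = A.card + 1 + B.card := by
    rw [← Finset.card_univ, ← huniv, Finset.card_union_of_disjoint hAwB,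
      Finset.card_union_of_disjoint hwA, Finset.card_singleton]
  rw [h6, show A.card + 1 + B.card - 1 = A.card + B.card by omega, mul_add] at hd
  omega

/-- Many leaves. -/
theorem hasKeyring_of_le_two_mul [Fintype V] [DecidableEq V] {G : SimpleGraph V}
    [DecidableRel G.Adj] {r k : ℕ} (hr : r + 3 ≤ k) (hrk : k ≤ 2 * r)
    (hd : (k - 1) * Fintype.card V < G.adjCount univ univ) : HasKeyring G r k := by
  obtain ⟨W, _, _, H, _, f, hd, hmin⟩ := G.exists_minimal_induced (fun n => (k - 1) * (n - 1))
    ((Nat.mul_le_mul_left _ (Nat.sub_le _ _)).trans_lt hd)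
  refine HasKeyring.map f ?_
  have hG := noCutVertex_of_minimal hd hmin
  set N := Fintype.card W with hN
  have hsum : ∀ b, (∀ v, H.degree v ≤ b) → H.adjCount univ univ ≤ N * b := fun b hb => by
    rw [adjCount_univ_right, hN, ← Finset.card_univ, ← smul_eq_mul]
    exact Finset.sum_le_card_nsmul _ _ _ fun v _ => hb v
  have hNk : k ≤ N := by
    by_contra! hlt
    have h1 := hsum (N - 1) fun v => Nat.le_sub_one_of_lt (H.degree_lt_card_verts v)
    have h2 : N * (N - 1) ≤ (k - 1) * (N - 1) := Nat.mul_le_mul_right _ (by omega)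
    omega
  have hle : (k - 2) * N ≤ (k - 1) * (N - 1) := by
    obtain ⟨k, rfl⟩ := Nat.exists_eq_add_of_le' (show 2 ≤ k by omega)
    obtain ⟨N', hN'⟩ := Nat.exists_eq_add_of_le' (show 1 ≤ N by omega)
    rw [hN'] at hNk ⊢
    simp only [Nat.add_sub_cancel, show k + 2 - 1 = k + 1 by omega]
    nlinarith
  obtain ⟨u, hu⟩ : ∃ u, k ≤ H.degree u + 1 := by
    by_contra! hlt
    have h1 := hsum (k - 2) fun v => by have := hlt v; omega
    rw [mul_comm] at h1
    omega
  obtain ⟨v, l, hl, hlk⟩ := SimpleGraph.exists_isCycleList (G := H) (K := k - 1) (by omega)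
    (hle.trans_lt hd)
  obtain ⟨L, hL, hlen⟩ := hG.exists_isCycleList (u := u) hl
  exact hL.hasKeyring_of_le_degree hr (by omega) hu

end SimpleGraph

/-- For every `0 ≤ r ≤ k-3`, every simple graph on `n` vertices with more than
`(k-1)n/2` edges contains a keyring with exactly `r` leaves and at least `k` edges. -/
theorem stmt_10 {V : Type*} [Fintype V] [DecidableEq V] (G : SimpleGraph V)
    [DecidableRel G.Adj] (n k r : ℕ) (hn : Fintype.card V = n)
    (hr : r + 3 ≤ k)
    (he : ((k : ℝ) - 1) * n / 2 < G.edgeFinset.card) :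
    HasKeyring G r k := by
  have hd : (k - 1) * Fintype.card V < G.adjCount Finset.univ Finset.univ := by
    rw [G.adjCount_univ_right, G.sum_degrees_eq_twice_card_edges, hn]
    have hk : ((k - 1 : ℕ) : ℝ) = (k : ℝ) - 1 := by
      rw [Nat.cast_sub (by omega), Nat.cast_one]
    rw [← hk] at he
    have h2 : (((k - 1 : ℕ) * n : ℕ) : ℝ) < (2 * G.edgeFinset.card : ℕ) := by
      push_cast
      linarith
    exact_mod_cast h2
  rcases lt_or_ge (2 * r) k with h | h
  · exact SimpleGraph.hasKeyring_of_two_mul_lt (by omega) h hd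
  · exact SimpleGraph.hasKeyring_of_le_two_mul hr h hd
end
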